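/- The polynomial w = xyz + x′y′z′ + e′zy′ + ez′y + z′e′x + zex′ + yx′e′ + y′xe ∈ R does not belong to 𝓘, but 2w belongs to 𝓘. Consequently, since w is Q₈-invariant and lies in the kernel of π, the class of w is a nonzero 2-torsion element of the quotient (ker π)^{Q₈}/𝓘. -/

import Mathlib

set_option synthInstance.maxHeartbeats 1000000
set_option maxHeartbeats 1000000

open MvPolynomial QuaternionGroup

/-- The quaternion group `Q₈ = {1, −1, i, −i, j, −j, k, −k}` of order `8`.
Concretely, `1 = a 0`, `−1 = a 2`, `i = a 1`, `−i = a 3`, `j = xa 0`, `−j = xa 2`,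
`k = xa 3`, `−k = xa 1`. -/
abbrev Q8 : Type := QuaternionGroup 2

/-- The polynomial ring `R = ℤ[u_g : g ∈ Q₈]`. -/
abbrev R8 : Type := MvPolynomial Q8 ℤ

/-- The action of `g ∈ Q₈` on `R` by the `ℤ`-algebra automorphism permuting the
variables by left translation: `g • u_h = u_{g h}`. -/
noncomputable def act (g : Q8) : R8 →ₐ[ℤ] R8 :=
  rename (fun h : Q8 => g * h)

noncomputable def eV : R8 := X (a 0)
noncomputable def e'V : R8 := X (a 2)
noncomputable def xV : R8 := X (a 1)
noncomputable def x'V : R8 := X (a 3)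
noncomputable def yV : R8 := X (xa 0)
noncomputable def y'V : R8 := X (xa 2)
noncomputable def zV : R8 := X (xa 3)
noncomputable def z'V : R8 := X (xa 1)

/-- The polynomial `w = xyz + x′y′z′ + e′zy′ + ez′y + z′e′x + zex′ + yx′e′ + y′xe`. -/
noncomputable def w : R8 :=
  xV * yV * zV + x'V * y'V * z'V + e'V * zV * y'V + eV * z'V * yV
    + z'V * e'V * xV + zV * eV * x'V + yV * x'V * e'V + y'V * xV * eV


/-- The `ℤ`-algebra homomorphism `π : R → ℤ[X₀, X₁, X₂, X₃]` with `π(e) = X₀`,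
`π(e′) = −X₀`, `π(x) = X₁`, `π(x′) = −X₁`, `π(y) = X₂`, `π(y′) = −X₂`, `π(z) = X₃`,
`π(z′) = −X₃`. -/
noncomputable def piQ : R8 →ₐ[ℤ] MvPolynomial (Fin 4) ℤ :=
  aeval (fun g : Q8 =>
    match g with
    | .a i => if i = 0 then (X 0 : MvPolynomial (Fin 4) ℤ)
        else if i = 2 then - X 0 else if i = 1 then X 1 else - X 1
    | .xa i => if i = 0 then (X 2 : MvPolynomial (Fin 4) ℤ)
        else if i = 2 then - X 2 else if i = 3 then X 3 else - X 3)

/-- The `ℤ`-subalgebra `A ⊆ R` generated by `e+e′, x+x′, y+y′, z+z′`. -/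
noncomputable def Asub : Subalgebra ℤ R8 :=
  Algebra.adjoin ℤ ({eV + e'V, xV + x'V, yV + y'V, zV + z'V} : Set R8)

/-- The induction `Ind^{Q₈}_H(u) = Σ_g g·u` of `u ∈ R` from a subgroup `H ≤ Q₈` to
`Q₈`, the sum running over a set of representatives of the left cosets of `H` in `Q₈`
(for `H`-invariant `u` it is independent of the choice of representatives). -/
noncomputable def ind (H : Subgroup Q8) (u : R8) : R8 :=
  haveI : Fintype (Q8 ⧸ H) := Fintype.ofFinite _
  ∑ c : Q8 ⧸ H, act (Quotient.out c) u

/-- The additive subgroup `𝓘` of `R`, generated by the elements `Ind^{Q₈}_H(p·q)` where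
`H` ranges over all subgroups of `Q₈`, `p ∈ A⁺` is `H`-invariant and `q ∈ R` is
`H`-invariant. -/
noncomputable def Igrp : AddSubgroup R8 := AddSubgroup.closure
  {r : R8 | ∃ (H : Subgroup Q8) (p q : R8),
    p ∈ Asub ∧ MvPolynomial.constantCoeff p = 0 ∧
    (∀ h ∈ H, act h p = p) ∧ (∀ h ∈ H, act h q = q) ∧
    r = ind H (p * q)}

theorem central_mul_comm (g h : Q8) : g * (a 2 * h) = a 2 * (g * h) := by
  revert g h; decide

theorem central_mul_central_mul (g : Q8) : a 2 * (a 2 * g) = g := by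
  revert g; decide

theorem act_X (g h : Q8) : act g (X h) = X (g * h) := by
  simp [act]

theorem act_one (f : R8) : act 1 f = f := by
  simp only [act, one_mul]
  exact rename_id_apply f

theorem act_mul (g h : Q8) (f : R8) : act (g * h) f = act g (act h f) := by
  simp only [act, rename_rename]
  congr 2
  funext k
  exact mul_assoc g h k

theorem constantCoeff_act (g : Q8) (f : R8) : constantCoeff (act g f) = constantCoeff f := by
  simp [act, constantCoeff_rename]

theorem act_pderiv (g h : Q8) (f : R8) : act g (pderiv h f) = pderiv (g * h) (act g f) :=
  (pderiv_rename (mul_right_injective g) h f).symm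

/-- The derivation `∂/∂u_g + ∂/∂u_{-g}` of `R`. -/
noncomputable def foldDeriv (g : Q8) : Derivation ℤ R8 R8 := pderiv g + pderiv (a 2 * g)

theorem foldDeriv_apply (g : Q8) (f : R8) :
    foldDeriv g f = pderiv g f + pderiv (a 2 * g) f := rfl

theorem act_foldDeriv (g h : Q8) (f : R8) :
    act g (foldDeriv h f) = foldDeriv (g * h) (act g f) := by
  simp only [foldDeriv_apply, map_add, act_pderiv, central_mul_comm]

theorem foldDeriv_central_mul (g : Q8) (f : R8) : foldDeriv (a 2 * g) f = foldDeriv g f := by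
  simp only [foldDeriv_apply, central_mul_central_mul, add_comm]

theorem act_central_foldDeriv (g : Q8) (f : R8) :
    act (a 2) (foldDeriv g f) = foldDeriv g (act (a 2) f) := by
  rw [act_foldDeriv, foldDeriv_central_mul]

theorem Asub_eq : Asub = Algebra.adjoin ℤ (Set.range fun g : Q8 => (X g + X (a 2 * g) : R8)) := by
  unfold Asub
  congr 1
  ext f
  simp only [Set.mem_insert_iff, Set.mem_singleton_iff, Set.mem_range]
  constructor
  · rintro (rfl | rfl | rfl | rfl)
    exacts [⟨a 0, rfl⟩, ⟨a 1, rfl⟩, ⟨xa 0, rfl⟩, ⟨xa 3, rfl⟩]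
  · rintro ⟨g, rfl⟩
    have hg : g = a 0 ∨ g = a 2 ∨ g = a 1 ∨ g = a 3 ∨ g = xa 0 ∨ g = xa 2 ∨ g = xa 3 ∨ g = xa 1 := by
      revert g; decide
    rcases hg with rfl | rfl | rfl | rfl | rfl | rfl | rfl | rfl
    · exact .inl rfl
    · exact .inl (add_comm _ _)
    · exact .inr (.inl rfl)
    · exact .inr (.inl (add_comm _ _))
    · exact .inr (.inr (.inl rfl))
    · exact .inr (.inr (.inl (add_comm _ _)))
    · exact .inr (.inr (.inr rfl))
    · exact .inr (.inr (.inr (add_comm _ _)))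

theorem act_mem_Asub (g : Q8) {p : R8} (hp : p ∈ Asub) : act g p ∈ Asub := by
  rw [Asub_eq] at hp ⊢
  induction hp using Algebra.adjoin_induction with
  | mem f hf =>
    obtain ⟨h, rfl⟩ := hf
    refine Algebra.subset_adjoin ⟨g * h, ?_⟩
    simp only [map_add, act_X, central_mul_comm]
  | algebraMap r => simpa only [AlgHom.commutes] using Subalgebra.algebraMap_mem _ r
  | add f f' _ _ hf hf' => simpa only [map_add] using add_mem hf hf'
  | mul f f' _ _ hf hf' => simpa only [map_mul] using mul_mem hf hf'

theorem foldDeriv_X_add_X (g h : Q8) :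
    ∃ n : ℤ, foldDeriv g (X h + X (a 2 * h)) = 2 * algebraMap ℤ R8 n := by
  have key : ∀ g h : Q8, ∃ n : ℤ, (Pi.single g 1 : Q8 → ℤ) h + (Pi.single (a 2 * g) 1 : Q8 → ℤ) h
      + ((Pi.single g 1 : Q8 → ℤ) (a 2 * h) + (Pi.single (a 2 * g) 1 : Q8 → ℤ) (a 2 * h)) = 2 * n := by
    intro g h
    by_cases hg : h = g ∨ h = a 2 * g
    · exact ⟨1, by revert g h; decide⟩
    · exact ⟨0, by revert g h; decide⟩
  obtain ⟨n, hn⟩ := key g h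
  refine ⟨n, ?_⟩
  have hs : ∀ g h : Q8, (Pi.single g 1 : Q8 → R8) h
      = algebraMap ℤ R8 ((Pi.single g 1 : Q8 → ℤ) h) := by
    intro g h
    by_cases hg : h = g
    · subst hg; simp
    · simp [hg]
  simp only [foldDeriv_apply, map_add, pderiv_X, hs]
  simp only [← map_add, hn, map_mul, map_ofNat]

theorem foldDeriv_Asub (g : Q8) {p : R8} (hp : p ∈ Asub) :
    ∃ p' ∈ Asub, foldDeriv g p = 2 * p' := by
  rw [Asub_eq] at hp ⊢
  induction hp using Algebra.adjoin_induction with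
  | mem f hf =>
    obtain ⟨h, rfl⟩ := hf
    obtain ⟨n, hn⟩ := foldDeriv_X_add_X g h
    exact ⟨_, Subalgebra.algebraMap_mem _ n, hn⟩
  | algebraMap r => exact ⟨0, zero_mem _, by simp⟩
  | add f f' _ _ hf hf' =>
    obtain ⟨r, hr, e⟩ := hf
    obtain ⟨r', hr', e'⟩ := hf'
    exact ⟨r + r', add_mem hr hr', by rw [map_add, e, e']; ring⟩
  | mul f f' hA hA' hf hf' =>
    obtain ⟨r, hr, e⟩ := hf
    obtain ⟨r', hr', e'⟩ := hf'
    refine ⟨f * r' + f' * r, add_mem (mul_mem hA hr') (mul_mem hA' hr), ?_⟩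
    rw [Derivation.leibniz, e, e', smul_eq_mul, smul_eq_mul]; ring

theorem two_dvd_constantCoeff_foldDeriv (g : Q8) {r : R8} (hr : act (a 2) r = r) :
    2 ∣ constantCoeff (foldDeriv g r) := by
  refine ⟨constantCoeff (pderiv g r), ?_⟩
  have h : constantCoeff (pderiv (a 2 * g) r) = constantCoeff (pderiv g r) := by
    rw [← constantCoeff_act (a 2) (pderiv g r), act_pderiv, hr]
  rw [foldDeriv_apply, map_add, h, two_mul]

/-- The coefficient of `X₁X₂X₃` in the image of a polynomial under
`u_g, u_{-g} ↦ X_{±g}`. -/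
noncomputable def foldCoeff : R8 →+ ℤ :=
  (constantCoeff : R8 →+* ℤ).toAddMonoidHom.comp
    ((foldDeriv (a 1)).toLinearMap.toAddMonoidHom.comp
      ((foldDeriv (xa 0)).toLinearMap.toAddMonoidHom.comp
        (foldDeriv (xa 3)).toLinearMap.toAddMonoidHom))

theorem foldCoeff_apply (f : R8) :
    foldCoeff f = constantCoeff (foldDeriv (a 1) (foldDeriv (xa 0) (foldDeriv (xa 3) f))) := rfl

theorem foldCoeff_act_central (f : R8) : foldCoeff (act (a 2) f) = foldCoeff f := by
  simp only [foldCoeff_apply, ← act_central_foldDeriv, constantCoeff_act]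

theorem foldCoeff_mul {p : R8} (hp : p ∈ Asub) (hp₀ : constantCoeff p = 0) (q : R8) :
    ∃ l m n k : ℤ, foldCoeff (p * q) = 4 * k
      + 2 * (l * constantCoeff (foldDeriv (a 1) (foldDeriv (xa 0) q))
        + m * constantCoeff (foldDeriv (a 1) (foldDeriv (xa 3) q))
        + n * constantCoeff (foldDeriv (xa 0) (foldDeriv (xa 3) q))) := by
  obtain ⟨p₁, h₁, e₁⟩ := foldDeriv_Asub (a 1) hp
  obtain ⟨p₂, h₂, e₂⟩ := foldDeriv_Asub (xa 0) hp
  obtain ⟨p₃, h₃, e₃⟩ := foldDeriv_Asub (xa 3) hp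
  obtain ⟨p₁₂, -, e₁₂⟩ := foldDeriv_Asub (a 1) h₂
  obtain ⟨p₁₃, -, e₁₃⟩ := foldDeriv_Asub (a 1) h₃
  obtain ⟨p₂₃, h₂₃, e₂₃⟩ := foldDeriv_Asub (xa 0) h₃
  obtain ⟨p₁₂₃, -, e₁₂₃⟩ := foldDeriv_Asub (a 1) h₂₃
  have two : ∀ (g : Q8) (f : R8), foldDeriv g (2 * f) = 2 * foldDeriv g f := by
    intro g f
    rw [two_mul, two_mul, map_add]
  refine ⟨constantCoeff p₃, constantCoeff p₂, constantCoeff p₁,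
    constantCoeff (2 * p₁₂₃ * q + p₁₂ * foldDeriv (xa 3) q + p₁₃ * foldDeriv (xa 0) q
      + p₂₃ * foldDeriv (a 1) q), ?_⟩
  rw [foldCoeff_apply]
  simp only [Derivation.leibniz, smul_eq_mul, map_add, e₁, e₂, e₃, two, e₁₂, e₁₃, e₂₃, e₁₂₃,
    map_mul, hp₀, map_ofNat]
  ring

theorem two_dvd_foldCoeff_mul {p : R8} (hp : p ∈ Asub) (hp₀ : constantCoeff p = 0) (q : R8) :
    2 ∣ foldCoeff (p * q) := by
  obtain ⟨l, m, n, k, h⟩ := foldCoeff_mul hp hp₀ q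
  omega

theorem four_dvd_foldCoeff_mul {p q : R8} (hp : p ∈ Asub) (hp₀ : constantCoeff p = 0)
    (hq : act (a 2) q = q) : 4 ∣ foldCoeff (p * q) := by
  have inv (g : Q8) : act (a 2) (foldDeriv g q) = foldDeriv g q := by
    rw [act_central_foldDeriv, hq]
  obtain ⟨l, m, n, k, h⟩ := foldCoeff_mul hp hp₀ q
  obtain ⟨r, hr⟩ := two_dvd_constantCoeff_foldDeriv (a 1) (inv (xa 0))
  obtain ⟨s, hs⟩ := two_dvd_constantCoeff_foldDeriv (a 1) (inv (xa 3))
  obtain ⟨t, ht⟩ := two_dvd_constantCoeff_foldDeriv (xa 0) (inv (xa 3))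
  exact ⟨k + (l * r + m * s + n * t), by rw [h, hr, hs, ht]; ring⟩

theorem sum_Q8 {M : Type*} [AddCommMonoid M] (f : Q8 → M) :
    ∑ g, f g = f (a 0) + f (a 1) + f (a 2) + f (a 3)
      + f (xa 0) + f (xa 1) + f (xa 2) + f (xa 3) := by
  have h : (Finset.univ : Finset Q8) = {a 0, a 1, a 2, a 3, xa 0, xa 1, xa 2, xa 3} := by decide
  rw [h]
  repeat rw [Finset.sum_insert (by decide)]
  rw [Finset.sum_singleton]
  simp only [add_assoc]

theorem ind_bot (u : R8) : ind ⊥ u = ∑ g, act g u := by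
  let : Fintype (Q8 ⧸ (⊥ : Subgroup Q8)) := Fintype.ofFinite _
  refine Fintype.sum_bijective (Quotient.out : Q8 ⧸ (⊥ : Subgroup Q8) → Q8)
    ⟨Quotient.out_injective, fun g => ⟨(g : Q8 ⧸ (⊥ : Subgroup Q8)), ?_⟩⟩ _ _ fun _ => rfl
  obtain ⟨h, hh⟩ := QuotientGroup.mk_out_eq_mul (⊥ : Subgroup Q8) g
  have h1 : (h : Q8) = 1 := Subgroup.mem_bot.mp h.2
  rw [h1, mul_one] at hh
  exact hh

theorem eq_bot_of_central_notMem {H : Subgroup Q8} (h : a 2 ∉ H) : H = ⊥ := by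
  rw [Subgroup.eq_bot_iff_forall]
  intro g hg
  have key : ∀ g : Q8, g = 1 ∨ g = a 2 ∨ g * g = a 2 := by decide
  rcases key g with h1 | h1 | h1
  · exact h1
  · exact absurd (h1 ▸ hg) h
  · exact absurd (h1 ▸ mul_mem hg hg) h

theorem four_dvd_foldCoeff_ind {H : Subgroup Q8} {p q : R8} (hp : p ∈ Asub)
    (hp₀ : constantCoeff p = 0) (hq : ∀ h ∈ H, act h q = q) :
    4 ∣ foldCoeff (ind H (p * q)) := by
  by_cases hH : a 2 ∈ H
  · unfold ind
    rw [map_sum]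
    refine Finset.dvd_sum fun c _ => ?_
    rw [map_mul]
    refine four_dvd_foldCoeff_mul (act_mem_Asub _ hp) (by rw [constantCoeff_act, hp₀]) ?_
    have comm : ∀ g : Q8, a 2 * g = g * a 2 := by decide
    rw [← act_mul, comm, act_mul, hq _ hH]
  · rw [eq_bot_of_central_notMem hH, ind_bot, map_sum, sum_Q8]
    have even (g : Q8) : 2 ∣ foldCoeff (act g (p * q)) := by
      rw [map_mul]
      exact two_dvd_foldCoeff_mul (act_mem_Asub _ hp) (by rw [constantCoeff_act, hp₀]) _
    have central (g : Q8) : foldCoeff (act (a 2 * g) (p * q)) = foldCoeff (act g (p * q)) := by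
      rw [act_mul, foldCoeff_act_central]
    have h0 : foldCoeff (act (a 2) (p * q)) = foldCoeff (act (a 0) (p * q)) := central (a 0)
    have h1 : foldCoeff (act (a 3) (p * q)) = foldCoeff (act (a 1) (p * q)) := central (a 1)
    have h2 : foldCoeff (act (xa 2) (p * q)) = foldCoeff (act (xa 0) (p * q)) := central (xa 0)
    have h3 : foldCoeff (act (xa 3) (p * q)) = foldCoeff (act (xa 1) (p * q)) := central (xa 1)
    have e0 := even (a 0)
    have e1 := even (a 1)
    have e2 := even (xa 0)
    have e3 := even (xa 1)
    omega

theorem four_dvd_foldCoeff_of_mem_Igrp {f : R8} (hf : f ∈ Igrp) : 4 ∣ foldCoeff f := by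
  induction hf using AddSubgroup.closure_induction with
  | mem f hf =>
    obtain ⟨H, p, q, hp, hp₀, -, hq, rfl⟩ := hf
    exact four_dvd_foldCoeff_ind hp hp₀ hq
  | zero => simp
  | add f f' _ _ hf hf' => rw [map_add]; exact dvd_add hf hf'
  | neg f _ hf => rw [map_neg]; exact (dvd_neg).mpr hf

theorem w_eq_sum_act : w = ∑ g, act g (xV * yV * zV) := by
  rw [sum_Q8]
  simp only [map_mul, xV, yV, zV, act_X]
  change w = xV * yV * zV + e'V * zV * y'V + x'V * y'V * z'V + eV * z'V * yV
    + z'V * e'V * xV + y'V * xV * eV + zV * eV * x'V + yV * x'V * e'V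
  unfold w
  ring

theorem foldCoeff_w : foldCoeff w = 2 := by
  have hx (f : R8) : foldDeriv (a 1) f = pderiv (a 1) f + pderiv (a 3) f := rfl
  have hy (f : R8) : foldDeriv (xa 0) f = pderiv (xa 0) f + pderiv (xa 2) f := rfl
  have hz (f : R8) : foldDeriv (xa 3) f = pderiv (xa 3) f + pderiv (xa 1) f := rfl
  rw [foldCoeff_apply, hz, hy, hx]
  simp +decide [w, eV, e'V, xV, x'V, yV, y'V, zV, z'V, pderiv_X]

theorem w_notMem_Igrp : w ∉ Igrp := fun h => by
  have := four_dvd_foldCoeff_of_mem_Igrp h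
  rw [foldCoeff_w] at this
  omega

theorem act_w (g : Q8) : act g w = w := by
  rw [w_eq_sum_act, map_sum]
  simp only [← act_mul]
  exact Equiv.sum_comp (Equiv.mulLeft g) fun h => act h (xV * yV * zV)

theorem ind_bot_mem_Igrp {p : R8} (hp : p ∈ Asub) (hp₀ : constantCoeff p = 0) (q : R8) :
    ind ⊥ (p * q) ∈ Igrp := by
  have inv (f : R8) (h : Q8) (hh : h ∈ (⊥ : Subgroup Q8)) : act h f = f := by
    rw [Subgroup.mem_bot.mp hh, act_one]
  exact AddSubgroup.subset_closure ⟨⊥, p, q, hp, hp₀, inv p, inv q, rfl⟩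

theorem two_mul_w_mem_Igrp : 2 * w ∈ Igrp := by
  have key : 2 * w = ind ⊥ ((xV + x'V) * (yV * zV)) + ind ⊥ ((yV + y'V) * -(x'V * zV))
      + ind ⊥ ((zV + z'V) * (x'V * y'V)) := by
    have h : w = ∑ g, act g (x'V * y'V * z'V) := by
      have hc : x'V * y'V * z'V = act (a 2) (xV * yV * zV) := by
        simp only [map_mul, xV, yV, zV, act_X]
        rfl
      rw [hc, w_eq_sum_act]
      simp only [← act_mul]
      exact (Equiv.sum_comp (Equiv.mulRight (a 2 : Q8)) fun g => act g (xV * yV * zV)).symm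
    rw [two_mul]
    nth_rw 1 [w_eq_sum_act]
    rw [h]
    simp only [ind_bot, ← Finset.sum_add_distrib, ← map_add]
    refine Finset.sum_congr rfl fun g _ => congrArg _ ?_
    ring
  have sub : ∀ s ∈ ({eV + e'V, xV + x'V, yV + y'V, zV + z'V} : Set R8), s ∈ Asub :=
    fun s hs => Algebra.subset_adjoin hs
  rw [key]
  refine add_mem (add_mem ?_ ?_) ?_ <;> refine ind_bot_mem_Igrp (sub _ (by simp)) ?_ _ <;>
    simp [xV, x'V, yV, y'V, zV, z'V]

theorem piQ_w : piQ w = 0 := by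
  simp +decide only [piQ, w, eV, e'V, xV, x'V, yV, y'V, zV, z'V, map_add, map_mul, aeval_X,
    if_true, if_false]
  ring

/-- The polynomial
`w = xyz + x′y′z′ + e′zy′ + ez′y + z′e′x + zex′ + yx′e′ + y′xe ∈ R` does not belong to
`𝓘`, but `2w` belongs to `𝓘`.  Moreover `w` is `Q₈`-invariant and lies in the kernel of
`π`; consequently the class of `w` is a nonzero `2`-torsion element of the quotient
`(ker π)^{Q₈}/𝓘`. -/
theorem stmt14 :
    w ∉ Igrp ∧ 2 * w ∈ Igrp ∧ piQ w = 0 ∧ (∀ g : Q8, act g w = w) :=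
  ⟨w_notMem_Igrp, two_mul_w_mem_Igrp, piQ_w, act_w⟩
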